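/- Let L(n,k) be the number of boolean permutations in S_n of length k. Then for all n ≥ 1 and k ≥ 1, L(n,k) = Σ_{i=1}^{k} C(n−i, k+1−i)·C(k−1, i−1), where C(a,b) denotes the binomial coefficient (equal to 0 when b > a or b < 0); also L(n,0) = 1. -/

import Mathlib

namespace Paper

/-! ### Type A: the symmetric group `S_n` as `Equiv.Perm (Fin n)` -/

/-- The simple transposition `s_i ∈ S_n` (1-indexed letter `i`, meaningful for
`1 ≤ i ≤ n-1`): it interchanges the entries in (1-indexed) positions `i` and `i+1`,
i.e. (0-indexed) positions `i-1` and `i` of `Fin n`. Out-of-range letters give `1`. -/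
def sA (n : ℕ) (i : ℕ) : Equiv.Perm (Fin n) :=
  if h : 1 ≤ i ∧ i < n then Equiv.swap ⟨i - 1, by omega⟩ ⟨i, h.2⟩ else 1

/-- The product `s_{i_1} ⋯ s_{i_ℓ}` of a word `i_1 ⋯ i_ℓ`. -/
def prodA (n : ℕ) (w : List ℕ) : Equiv.Perm (Fin n) := (w.map (sA n)).prod

/-- A word in the letters `{1, …, n-1}`. -/
def IsWordA (n : ℕ) (w : List ℕ) : Prop := ∀ i ∈ w, 1 ≤ i ∧ i ≤ n - 1

/-- `w` is a reduced decomposition of `x ∈ S_n`. -/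
def ReducedA (n : ℕ) (w : List ℕ) (x : Equiv.Perm (Fin n)) : Prop :=
  IsWordA n w ∧ prodA n w = x ∧
    ∀ w' : List ℕ, IsWordA n w' → prodA n w' = x → w.length ≤ w'.length

/-- The Coxeter length `ℓ(x)`: minimal length of a word for `x`. -/
noncomputable def lenA (n : ℕ) (x : Equiv.Perm (Fin n)) : ℕ :=
  sInf {l | ∃ w : List ℕ, IsWordA n w ∧ prodA n w = x ∧ w.length = l}

/-- Bruhat order on `S_n`: `v ≤ w` iff some reduced decomposition of `v` is a
(not necessarily consecutive) subword of some reduced decomposition of `w`. -/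
def bruhatA (n : ℕ) (v w : Equiv.Perm (Fin n)) : Prop :=
  ∃ a b : List ℕ, ReducedA n a v ∧ ReducedA n b w ∧ a.Sublist b

/-- `w ∈ S_n` is boolean: the principal order ideal `B(w)`, ordered by the Bruhat
order, is order-isomorphic to the lattice of all subsets of `{1,…,r}` for some `r`. -/
def BooleanA (n : ℕ) (w : Equiv.Perm (Fin n)) : Prop :=
  ∃ (r : ℕ) (e : {v : Equiv.Perm (Fin n) // bruhatA n v w} ≃ Finset (Fin r)),
    ∀ a b : {v : Equiv.Perm (Fin n) // bruhatA n v w}, bruhatA n a.1 b.1 ↔ e a ⊆ e b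

/-- Pattern containment: `w ∈ S_n` contains `p ∈ S_k`. -/
def ContainsA {n k : ℕ} (w : Equiv.Perm (Fin n)) (p : Equiv.Perm (Fin k)) : Prop :=
  ∃ f : Fin k → Fin n, StrictMono f ∧ ∀ a b : Fin k, w (f a) < w (f b) ↔ p a < p b

/-- Pattern avoidance. -/
def AvoidsA {n k : ℕ} (w : Equiv.Perm (Fin n)) (p : Equiv.Perm (Fin k)) : Prop :=
  ¬ ContainsA w p

/-- The pattern `321` (one-line notation). -/
def p321 : Equiv.Perm (Fin 3) := ⟨![2,1,0], ![2,1,0], by decide, by decide⟩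
/-- The pattern `231` (one-line notation). -/
def p231 : Equiv.Perm (Fin 3) := ⟨![1,2,0], ![2,0,1], by decide, by decide⟩
/-- The pattern `312` (one-line notation). -/
def p312 : Equiv.Perm (Fin 3) := ⟨![2,0,1], ![1,2,0], by decide, by decide⟩
/-- The pattern `3412` (one-line notation). -/
def p3412 : Equiv.Perm (Fin 4) := ⟨![2,3,0,1], ![2,3,0,1], by decide, by decide⟩

/-- The longest (decreasing) permutation `w_0^{(k)} = k (k-1) ⋯ 2 1 ∈ S_k`. -/
def w0 (k : ℕ) : Equiv.Perm (Fin k) := Fin.revPerm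

/-- The shift of a word by `M`: each letter `i` becomes `i + M`. -/
def shift (M : ℕ) (w : List ℕ) : List ℕ := w.map (· + M)




/-! ### Types B and D: signed permutations, modelled as permutations `w` of `ℤ`
with `w(-x) = -w(x)` that fix all integers of absolute value `> n`. -/

/-- The simple generators of `S_n^B`, as permutations of `ℤ`:
`sB 0` negates the value `1`; for `i ≥ 1`, `sB i` interchanges the values
`i` and `i+1` (and `-i` and `-(i+1)`). -/
def sB : ℕ → Equiv.Perm ℤ
  | 0 => Equiv.swap 1 (-1)
  | (i+1) => Equiv.swap ((i : ℤ) + 1) ((i : ℤ) + 2) * Equiv.swap (-((i : ℤ) + 1)) (-((i : ℤ) + 2))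

/-- The simple generators of `S_n^D`: letter `0` encodes `s_{1'} = s_0 s_1 s_0`
(mapping `1 ↦ -2` and `2 ↦ -1`), and letters `i ≥ 1` are as in type `B`. -/
def sD : ℕ → Equiv.Perm ℤ
  | 0 => sB 0 * sB 1 * sB 0
  | (i+1) => sB (i+1)

def prodB (w : List ℕ) : Equiv.Perm ℤ := (w.map sB).prod
def prodD (w : List ℕ) : Equiv.Perm ℤ := (w.map sD).prod

/-- A word in the type `B`/`D` letters `{0, 1, …, n-1}`. -/
def IsWordBD (n : ℕ) (w : List ℕ) : Prop := ∀ i ∈ w, i ≤ n - 1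

/-- `w` is a reduced decomposition of `x ∈ S_n^B`. -/
def ReducedB (n : ℕ) (w : List ℕ) (x : Equiv.Perm ℤ) : Prop :=
  IsWordBD n w ∧ prodB w = x ∧
    ∀ w' : List ℕ, IsWordBD n w' → prodB w' = x → w.length ≤ w'.length

/-- `w` is a reduced decomposition of `x ∈ S_n^D`. -/
def ReducedD (n : ℕ) (w : List ℕ) (x : Equiv.Perm ℤ) : Prop :=
  IsWordBD n w ∧ prodD w = x ∧
    ∀ w' : List ℕ, IsWordBD n w' → prodD w' = x → w.length ≤ w'.length

/-- Length in `S_n^B`. -/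
noncomputable def lenB (n : ℕ) (x : Equiv.Perm ℤ) : ℕ :=
  sInf {l | ∃ w : List ℕ, IsWordBD n w ∧ prodB w = x ∧ w.length = l}

/-- Length in `S_n^D`. -/
noncomputable def lenD (n : ℕ) (x : Equiv.Perm ℤ) : ℕ :=
  sInf {l | ∃ w : List ℕ, IsWordBD n w ∧ prodD w = x ∧ w.length = l}

/-- Bruhat order on `S_n^B`. -/
def bruhatB (n : ℕ) (v w : Equiv.Perm ℤ) : Prop :=
  ∃ a b : List ℕ, ReducedB n a v ∧ ReducedB n b w ∧ a.Sublist b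

/-- Bruhat order on `S_n^D`. -/
def bruhatD (n : ℕ) (v w : Equiv.Perm ℤ) : Prop :=
  ∃ a b : List ℕ, ReducedD n a v ∧ ReducedD n b w ∧ a.Sublist b

/-- `w` is an element of `S_n^B`: an "odd" permutation of `{±1, …, ±n}`. -/
def IsSignedPerm (n : ℕ) (w : Equiv.Perm ℤ) : Prop :=
  (∀ x : ℤ, w (-x) = - w x) ∧ ∀ x : ℤ, (n : ℤ) < |x| → w x = x

/-- `w` is an element of `S_n^D`: a signed permutation with an even number of
negative values in its one-line notation. -/
def IsTypeD (n : ℕ) (w : Equiv.Perm ℤ) : Prop :=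
  IsSignedPerm n w ∧ Even (((Finset.Icc (1 : ℤ) n).filter (fun x => w x < 0)).card)

/-- `w ∈ S_n^B` is boolean (for the type `B` Bruhat order). -/
def BooleanB (n : ℕ) (w : Equiv.Perm ℤ) : Prop :=
  ∃ (r : ℕ) (e : {v : Equiv.Perm ℤ // bruhatB n v w} ≃ Finset (Fin r)),
    ∀ a b : {v : Equiv.Perm ℤ // bruhatB n v w}, bruhatB n a.1 b.1 ↔ e a ⊆ e b

/-- `w ∈ S_n^D` is boolean (for the type `D` Bruhat order). -/
def BooleanD (n : ℕ) (w : Equiv.Perm ℤ) : Prop :=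
  ∃ (r : ℕ) (e : {v : Equiv.Perm ℤ // bruhatD n v w} ≃ Finset (Fin r)),
    ∀ a b : {v : Equiv.Perm ℤ // bruhatD n v w}, bruhatD n a.1 b.1 ↔ e a ⊆ e b

/-- Signed pattern containment, where the pattern is given by its one-line
notation `p` (a list of nonzero integers): there are positions
`1 ≤ f 0 < ⋯ < f (k-1) ≤ n` such that each `w (f j)` has the same sign as the
`j`-th entry of `p`, and the absolute values appear in the same relative order. -/
def containsPat (n : ℕ) (w : Equiv.Perm ℤ) (p : List ℤ) : Prop :=
  ∃ f : Fin p.length → ℤ, StrictMono f ∧ (∀ j, 1 ≤ f j ∧ f j ≤ (n : ℤ)) ∧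
    (∀ j, 0 < w (f j) ↔ 0 < p.get j) ∧
    (∀ j j', |w (f j)| < |w (f j')| ↔ |p.get j| < |p.get j'|)

/-- Signed pattern avoidance. -/
def avoidsPat (n : ℕ) (w : Equiv.Perm ℤ) (p : List ℤ) : Prop := ¬ containsPat n w p


/-! ### Extra definitions used in some statements -/

/-- `w ∈ S_n` is decomposable: `B(w) ≅ B(u) × B(v)` (as posets under Bruhat order)
for some `u ∈ S_m`, `v ∈ S_{m'}` with `m, m' < n`. -/
def Decomposable (n : ℕ) (w : Equiv.Perm (Fin n)) : Prop :=
  ∃ (m m' : ℕ), m < n ∧ m' < n ∧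
    ∃ (u : Equiv.Perm (Fin m)) (v : Equiv.Perm (Fin m'))
      (e : {x : Equiv.Perm (Fin n) // bruhatA n x w} ≃
        {y : Equiv.Perm (Fin m) // bruhatA m y u} × {z : Equiv.Perm (Fin m') // bruhatA m' z v}),
      ∀ a b : {x : Equiv.Perm (Fin n) // bruhatA n x w},
        bruhatA n a.1 b.1 ↔
          (bruhatA m ((e a).1).1 ((e b).1).1 ∧ bruhatA m' ((e a).2).1 ((e b).2).1)

/-- `w` is decreasing on the set of positions `T`. -/
def DecrOn (n : ℕ) (w : Equiv.Perm (Fin n)) (T : Finset (Fin n)) : Prop :=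
  ∀ a ∈ T, ∀ b ∈ T, a < b → w b < w a

/-- Every inversion of `w` lies in exactly one occurrence of the decreasing
pattern `w_0^{(k)}`: for every `i < j` with `w i > w j` there is exactly one
`k`-element set of positions containing `i` and `j` on which `w` is decreasing. -/
def EveryInvOnce (n k : ℕ) (w : Equiv.Perm (Fin n)) : Prop :=
  ∀ i j : Fin n, i < j → w j < w i →
    ∃! T : Finset (Fin n), T.card = k ∧ DecrOn n w T ∧ i ∈ T ∧ j ∈ T

/-- Equality of two patterns of (possibly a priori different) sizes. -/
def EqPat {k m : ℕ} (p : Equiv.Perm (Fin k)) (q : Equiv.Perm (Fin m)) : Prop :=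
  ∃ h : k = m, ∀ i : Fin k, ((p i : ℕ) = (q (Fin.cast h i) : ℕ))

/-- `L(n,k)`: the number of boolean permutations in `S_n` of length `k`. -/
noncomputable def LA (n k : ℕ) : ℕ :=
  Nat.card {w : Equiv.Perm (Fin n) // BooleanA n w ∧ lenA n w = k}

/-- `L` extended to integer arguments, with the convention that it vanishes
when `m < 1` or `j < 0`. -/
noncomputable def Lz (m j : ℤ) : ℤ :=
  if 1 ≤ m ∧ 0 ≤ j then (LA m.toNat j.toNat : ℤ) else 0

/-- `L^D(n,k)`: the number of boolean elements of `S_n^D` of length `k`. -/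
noncomputable def LD (n k : ℕ) : ℕ :=
  Nat.card {w : Equiv.Perm ℤ // IsTypeD n w ∧ BooleanD n w ∧ lenD n w = k}

/-! ### Basic facts on products of words -/

lemma prodA_cons (n i : ℕ) (b : List ℕ) : prodA n (i :: b) = sA n i * prodA n b := by
  simp [prodA]

lemma prodA_append (n : ℕ) (a b : List ℕ) : prodA n (a ++ b) = prodA n a * prodA n b := by
  simp [prodA]

lemma prodA_nil (n : ℕ) : prodA n [] = 1 := by simp [prodA]

lemma sA_val (n i : ℕ) (h1 : 1 ≤ i) (h2 : i < n) (x : Fin n) :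
    (sA n i x : ℕ) = if (x : ℕ) = i - 1 then i else if (x : ℕ) = i then i - 1 else x := by
  unfold sA
  rw [dif_pos ⟨h1, h2⟩, Equiv.swap_apply_def]
  simp only [Fin.ext_iff]
  split_ifs <;> simp_all

lemma sA_mul_self (n i : ℕ) : sA n i * sA n i = 1 := by
  unfold sA
  split_ifs <;> simp

lemma sA_inv (n i : ℕ) : (sA n i)⁻¹ = sA n i :=
  inv_eq_of_mul_eq_one_left (sA_mul_self n i)

lemma sA_comm (n i j : ℕ) (h : i + 1 < j ∨ j + 1 < i ∨ i = j) :
    sA n i * sA n j = sA n j * sA n i := by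
  by_cases hi : 1 ≤ i ∧ i < n
  · by_cases hj : 1 ≤ j ∧ j < n
    · ext x
      simp only [Equiv.Perm.mul_apply, sA_val n i hi.1 hi.2, sA_val n j hj.1 hj.2]
      split_ifs <;> omega
    · have : sA n j = 1 := by unfold sA; rw [dif_neg hj]
      simp [this]
  · have : sA n i = 1 := by unfold sA; rw [dif_neg hi]
    simp [this]

/-- `w` preserves the initial segment of size `i`. -/
def Pres (n i : ℕ) (w : Equiv.Perm (Fin n)) : Prop :=
  ∀ x : Fin n, (w x : ℕ) < i ↔ (x : ℕ) < i

lemma pres_mul {n i : ℕ} {u v : Equiv.Perm (Fin n)} (hu : Pres n i u) (hv : Pres n i v) :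
    Pres n i (u * v) := fun x => by
  rw [Equiv.Perm.mul_apply, hu, hv]

lemma pres_inv {n i : ℕ} {u : Equiv.Perm (Fin n)} (hu : Pres n i u) : Pres n i u⁻¹ := fun x => by
  have := hu (u⁻¹ x)
  rw [← this]; simp

lemma pres_sA {n i j : ℕ} (h : i ≠ j) : Pres n i (sA n j) := fun x => by
  by_cases hj : 1 ≤ j ∧ j < n
  · rw [sA_val n j hj.1 hj.2]
    split_ifs <;> omega
  · have : sA n j = 1 := by unfold sA; rw [dif_neg hj]
    simp [this]

lemma not_pres_sA {n i : ℕ} (h1 : 1 ≤ i) (h2 : i < n) : ¬ Pres n i (sA n i) := fun h => by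
  have := h ⟨i, h2⟩
  rw [sA_val n i h1 h2] at this
  simp at this
  split_ifs at this <;> omega

lemma pres_prodA {n i : ℕ} {b : List ℕ} (h : i ∉ b) : Pres n i (prodA n b) := by
  induction b with
  | nil => intro x; simp [prodA]
  | cons j b ih =>
    simp only [List.mem_cons, not_or] at h
    rw [prodA_cons]
    exact pres_mul (pres_sA h.1) (ih h.2)

lemma not_pres_of_nodup {n i : ℕ} {b : List ℕ} (hw : IsWordA n b) (hb : b.Nodup) (h : i ∈ b) :
    ¬ Pres n i (prodA n b) := by
  intro hp
  obtain ⟨a, c, rfl⟩ := List.append_of_mem h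
  have hi := hw i h
  have ha : i ∉ a := fun hh => by
    have := List.nodup_middle.1 hb
    simp at this
    tauto
  have hc : i ∉ c := fun hh => by
    have := List.nodup_middle.1 hb
    simp at this
    tauto
  rw [prodA_append, prodA_cons] at hp
  have h2 := pres_mul (pres_mul (pres_inv (pres_prodA (n := n) ha)) hp)
    (pres_inv (pres_prodA (n := n) hc))
  refine not_pres_sA hi.1 (by omega) (?_ : Pres n i (sA n i))
  convert h2 using 1
  group

/-- Exchange lemma. -/
lemma exchange {n : ℕ} (c : List ℕ) (x y : Fin n) (hc : IsWordA n c) (hxy : x < y)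
    (h : (prodA n c)⁻¹ y < (prodA n c)⁻¹ x) :
    ∃ c', IsWordA n c' ∧ c'.length < c.length ∧ prodA n c' = Equiv.swap x y * prodA n c := by
  induction c generalizing x y with
  | nil => simp [prodA] at h; exact absurd h (not_lt.2 hxy.le)
  | cons j c ih =>
    have hj := hc j (by simp)
    have hc' : IsWordA n c := fun i hi => hc i (by simp [hi])
    rw [prodA_cons, mul_inv_rev, sA_inv] at h
    simp only [Equiv.Perm.mul_apply] at h
    by_cases hlt : sA n j x < sA n j y
    · obtain ⟨c', h1, h2, h3⟩ := ih _ _ hc' hlt h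
      refine ⟨j :: c', ?_, by simpa using h2, ?_⟩
      · intro i hi
        rcases List.mem_cons.1 hi with rfl | hi
        · exact hj
        · exact h1 i hi
      · rw [prodA_cons, prodA_cons, h3, ← mul_assoc, ← mul_assoc]
        congr 1
        rw [Equiv.mul_swap_eq_swap_mul]
        congr 2
        · rw [← Equiv.Perm.mul_apply, sA_mul_self]; rfl
        · rw [← Equiv.Perm.mul_apply, sA_mul_self]; rfl
    · refine ⟨c, hc', by simp, ?_⟩
      have hjn : j < n := by have := x.2; omega
      have e1 := sA_val n j hj.1 hjn x
      have e2 := sA_val n j hj.1 hjn y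
      have hxy' : (x : ℕ) < y := hxy
      have hlt' : ¬ ((sA n j x : ℕ) < sA n j y) := hlt
      have hx : (x : ℕ) = j - 1 ∧ (y : ℕ) = j := by
        rw [e1, e2] at hlt'
        split_ifs at hlt' <;> omega
      have : Equiv.swap x y = sA n j := by
        unfold sA
        rw [dif_pos ⟨hj.1, hjn⟩]
        congr 1 <;> ext <;> simp [hx]
      rw [this, prodA_cons, ← mul_assoc, sA_mul_self, one_mul]

lemma not_pres_of_reduced {n i : ℕ} {b : List ℕ} {w : Equiv.Perm (Fin n)}
    (hb : ReducedA n b w) (h : i ∈ b) : ¬ Pres n i w := by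
  intro hp
  obtain ⟨hw, hprod, hmin⟩ := hb
  obtain ⟨q, c, rfl, hq⟩ := List.eq_append_cons_of_mem h
  have hi := hw i h
  have hin : i < n := by omega
  have hcw : IsWordA n c := fun j hj => hw j (by simp [hj])
  have hqw : IsWordA n q := fun j hj => hw j (by simp [hj])
  rw [prodA_append, prodA_cons] at hprod
  have hs : Pres n i (sA n i * prodA n c) := by
    have := pres_mul (pres_inv (pres_prodA (n := n) hq)) hp
    rw [← hprod] at this
    simpa using this
  have k1 := hs ((prodA n c)⁻¹ ⟨i - 1, by omega⟩)
  have k2 := hs ((prodA n c)⁻¹ ⟨i, hin⟩)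
  have hself : ∀ x, prodA n c ((prodA n c)⁻¹ x) = x := fun x => by
    rw [← Equiv.Perm.mul_apply, mul_inv_cancel]; rfl
  rw [Equiv.Perm.mul_apply, hself, sA_val n i hi.1 hin] at k1 k2
  have hlt : (prodA n c)⁻¹ ⟨i, hin⟩ < (prodA n c)⁻¹ ⟨i - 1, by omega⟩ := by
    rw [Fin.lt_def]
    simp only [if_true] at k1 k2
    split_ifs at k2 <;> omega
  obtain ⟨c', h1, h2, h3⟩ := exchange c ⟨i - 1, by omega⟩ ⟨i, hin⟩ hcw
    (by rw [Fin.lt_def]; simp; omega) hlt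
  have h4 : Equiv.swap (⟨i - 1, by omega⟩ : Fin n) ⟨i, hin⟩ = sA n i := by
    unfold sA; rw [dif_pos ⟨hi.1, hin⟩]
  have := hmin (q ++ c') (by
    intro j hj
    rcases List.mem_append.1 hj with hj | hj
    · exact hqw j hj
    · exact h1 j hj) (by rw [prodA_append, h3, h4, hprod])
  simp at this
  omega

lemma mem_of_not_pres {n i : ℕ} {b : List ℕ} (h : ¬ Pres n i (prodA n b)) : i ∈ b := by
  by_contra hh
  exact h (pres_prodA hh)

/-- Words with distinct letters are reduced. -/
lemma reduced_of_nodup {n : ℕ} {b : List ℕ} (hw : IsWordA n b) (hb : b.Nodup) :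
    ReducedA n b (prodA n b) := by
  refine ⟨hw, rfl, fun w' _ h' => ?_⟩
  have hsub : b.toFinset ⊆ w'.toFinset := by
    intro i hi
    rw [List.mem_toFinset] at *
    refine mem_of_not_pres (n := n) ?_
    rw [h']
    exact not_pres_of_nodup hw hb hi
  calc b.length = b.toFinset.card := (List.toFinset_card_of_nodup hb).symm
    _ ≤ w'.toFinset.card := Finset.card_le_card hsub
    _ ≤ _ := List.toFinset_card_le _

lemma reduced_mem_iff {n i : ℕ} {b : List ℕ} {w : Equiv.Perm (Fin n)}
    (hb : ReducedA n b w) : i ∈ b ↔ ¬ Pres n i w :=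
  ⟨not_pres_of_reduced hb, fun h => mem_of_not_pres (n := n) (by rwa [hb.2.1])⟩

lemma reduced_nodup {n : ℕ} {b b' : List ℕ} {w : Equiv.Perm (Fin n)}
    (hb : ReducedA n b w) (hb' : ReducedA n b' w) (h : b.Nodup) : b'.Nodup := by
  have h1 : b.toFinset = b'.toFinset := by
    ext i; simp only [List.mem_toFinset, reduced_mem_iff hb, reduced_mem_iff hb']
  have h2 : b'.length ≤ b.length := hb'.2.2 b hb.1 hb.2.1
  rw [← List.toFinset_card_of_nodup h, h1] at h2
  rw [← Multiset.coe_nodup, ← Multiset.toFinset_card_eq_card_iff_nodup]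
  exact le_antisymm (List.toFinset_card_le _) h2

lemma reduced_append_left {n : ℕ} {a b : List ℕ} {w : Equiv.Perm (Fin n)}
    (h : ReducedA n (a ++ b) w) : ReducedA n a (prodA n a) := by
  refine ⟨fun i hi => h.1 i (by simp [hi]), rfl, fun w' hw' hp => ?_⟩
  have := h.2.2 (w' ++ b) (by
    intro j hj
    rcases List.mem_append.1 hj with hj | hj
    · exact hw' j hj
    · exact h.1 j (by simp [hj])) (by rw [prodA_append, hp, ← prodA_append, h.2.1])
  simpa using this

lemma lenA_of_reduced {n : ℕ} {b : List ℕ} {w : Equiv.Perm (Fin n)}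
    (h : ReducedA n b w) : lenA n w = b.length := by
  refine le_antisymm (?_ : sInf _ ≤ _) (?_ : _ ≤ sInf _)
  · exact Nat.sInf_le ⟨b, h.1, h.2.1, rfl⟩
  · refine le_csInf ⟨b.length, b, h.1, h.2.1, rfl⟩ ?_
    rintro l ⟨w', h1, h2, rfl⟩
    exact h.2.2 w' h1 h2

lemma reduced_nil (n : ℕ) : ReducedA n [] 1 :=
  ⟨fun i hi => by simp at hi, prodA_nil n, fun _ _ _ => by simp⟩

/-- A boolean permutation has a reduced word with distinct letters. -/
lemma boolean_nodup {n : ℕ} {w : Equiv.Perm (Fin n)} (h : BooleanA n w) :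
    ∃ b, ReducedA n b w ∧ b.Nodup := by
  obtain ⟨r, e, he⟩ := h
  obtain ⟨v, hv⟩ := e.symm ∅
  obtain ⟨_, b, _, hb, _⟩ := hv
  refine ⟨b, hb, ?_⟩
  have hred : ∀ j, ReducedA n (b.take j) (prodA n (b.take j)) := fun j =>
    reduced_append_left (b := b.drop j) (w := w) (by rwa [List.take_append_drop])
  have hle : ∀ j, bruhatA n (prodA n (b.take j)) w := fun j =>
    ⟨b.take j, b, hred j, hb, List.take_sublist _ _⟩
  have hchain : ∀ j, j ≤ b.length → j ≤ (e ⟨_, hle j⟩).card := by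
    intro j
    induction j with
    | zero => simp
    | succ j ih =>
      intro hj
      have h1 := ih (by omega)
      have hsub : e ⟨_, hle j⟩ ⊆ e ⟨_, hle (j+1)⟩ :=
        (he _ _).1 ⟨b.take j, b.take (j+1), hred _, hred _,
          (List.take_prefix_take_left (by omega)).sublist⟩
      have hne : e ⟨_, hle j⟩ ≠ e ⟨_, hle (j+1)⟩ := by
        intro heq
        have := congrArg Subtype.val (e.injective heq)
        simp only at this
        have h3 := (hred (j+1)).2.2 (b.take j) (hred j).1 this
        simp at h3
        omega
      have := Finset.card_lt_card (hsub.ssubset_of_ne hne)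
      omega
  have hlr : b.length ≤ r := by
    have h1 := hchain b.length le_rfl
    have h2 := Finset.card_le_univ (e ⟨_, hle b.length⟩)
    simp at h2
    simp at h1
    omega
  have h1le : bruhatA n 1 w := ⟨[], b, reduced_nil n, hb, List.nil_sublist _⟩
  have hone : e ⟨1, h1le⟩ = ∅ := by
    rw [← Finset.subset_empty, ← e.apply_symm_apply ∅]
    refine (he _ _).1 ?_
    obtain ⟨v', hv'⟩ := e.symm ∅
    obtain ⟨a', b', ha', _, _⟩ := hv'
    exact ⟨[], a', reduced_nil n, ha', List.nil_sublist _⟩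
  have hatom : ∀ t : Fin r, ∃ i ∈ b.toFinset, ∃ hi : bruhatA n (sA n i) w,
      e ⟨sA n i, hi⟩ = {t} := by
    intro t
    obtain ⟨⟨v', hv'⟩, hvt⟩ := e.surjective {t}
    obtain ⟨a', b', ha', hb', hab⟩ := id hv'
    rcases a' with _ | ⟨i, a'⟩
    · have : v' = 1 := by rw [← ha'.2.1, prodA_nil]
      subst this
      rw [hone] at hvt
      exact absurd hvt.symm (Finset.singleton_ne_empty t)
    · have hi := ha'.1 i (by simp)
      have hib' : i ∈ b' := hab.subset (by simp)
      have hp : prodA n [i] = sA n i := by simp [prodA]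
      have hsred : ReducedA n [i] (sA n i) := by
        rw [← hp]
        exact reduced_of_nodup (fun j hj => by simp at hj; rwa [hj]) (by simp)
      have hsw : bruhatA n (sA n i) w := ⟨[i], b', hsred, hb', by simpa using hib'⟩
      refine ⟨i, ?_, hsw, ?_⟩
      · rw [List.mem_toFinset, reduced_mem_iff hb, ← reduced_mem_iff hb']
        exact hib'
      · have h1 : e ⟨sA n i, hsw⟩ ⊆ {t} := by
          rw [← hvt]
          exact (he _ _).1 ⟨[i], i :: a', hsred, ha', by simp⟩
        rcases Finset.subset_singleton_iff.1 h1 with h2 | h2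
        · exfalso
          rw [← hone] at h2
          have := congrArg Subtype.val (e.injective h2)
          simp only at this
          apply not_pres_sA (n := n) hi.1 (by omega)
          rw [this]
          intro x; simp
        · exact h2
  choose f hf hfi hfe using hatom
  have hinj : Function.Injective f := by
    intro t t' htt
    have : ({t} : Finset (Fin r)) = {t'} := by
      rw [← hfe t, ← hfe t']
      congr 2
      rw [htt]
    simpa using this
  have hrb : r ≤ b.toFinset.card := by
    have := Finset.card_le_card_of_injOn (s := Finset.univ) (t := b.toFinset) f
      (fun t _ => hf t) hinj.injOn
    simpa using this
  rw [← Multiset.coe_nodup, ← Multiset.toFinset_card_eq_card_iff_nodup]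
  exact le_antisymm (List.toFinset_card_le _) (hlr.trans hrb)

/-! ### Canonical words -/

/-- Canonical words with distinct letters in `{1, …, m}`. -/
def canW : ℕ → Finset (List ℕ)
  | 0 => {[]}
  | m + 1 => (canW m ∪ (canW m).image (fun b => (m + 1) :: b)) ∪
      ((canW m).filter (fun b => m ∈ b)).image (fun b => b ++ [m + 1])

lemma canW_mem_letters {m : ℕ} {b : List ℕ} (h : b ∈ canW m) : ∀ i ∈ b, 1 ≤ i ∧ i ≤ m := by
  induction m generalizing b with
  | zero => simp [canW] at h; simp [h]
  | succ m ih =>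
    simp only [canW, Finset.mem_union, Finset.mem_image, Finset.mem_filter] at h
    intro i hi
    rcases h with (h | ⟨b, h, rfl⟩) | ⟨b, ⟨h, _⟩, rfl⟩
    · have := ih h i hi; omega
    · rcases List.mem_cons.1 hi with rfl | hi
      · omega
      · have := ih h i hi; omega
    · simp only [List.mem_append, List.mem_singleton] at hi
      rcases hi with hi | rfl
      · have := ih h i hi; omega
      · omega

lemma canW_nodup {m : ℕ} {b : List ℕ} (h : b ∈ canW m) : b.Nodup := by
  induction m generalizing b with
  | zero => simp [canW] at h; simp [h]
  | succ m ih =>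
    simp only [canW, Finset.mem_union, Finset.mem_image, Finset.mem_filter] at h
    rcases h with (h | ⟨b, h, rfl⟩) | ⟨b, ⟨h, _⟩, rfl⟩
    · exact ih h
    · rw [List.nodup_cons]
      exact ⟨fun hh => by have := canW_mem_letters h _ hh; omega, ih h⟩
    · rw [List.nodup_append]
      refine ⟨ih h, by simp, ?_⟩
      intro a ha c hc hac
      simp at hc
      have := canW_mem_letters h _ ha
      omega

/-- Commutation equivalence (detected on all subwords given by a set of letters). -/
def CEq (n : ℕ) (a b : List ℕ) : Prop :=
  a.Perm b ∧ ∀ S : Finset ℕ, prodA n (a.filter (· ∈ S)) = prodA n (b.filter (· ∈ S))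

lemma CEq.trans {n : ℕ} {a b c : List ℕ} (h : CEq n a b) (h' : CEq n b c) : CEq n a c :=
  ⟨h.1.trans h'.1, fun S => (h.2 S).trans (h'.2 S)⟩

lemma CEq.append {n : ℕ} {a b c d : List ℕ} (h : CEq n a b) (h' : CEq n c d) :
    CEq n (a ++ c) (b ++ d) :=
  ⟨h.1.append h'.1, fun S => by
    rw [List.filter_append, List.filter_append, prodA_append, prodA_append, h.2, h'.2]⟩

lemma CEq.rfl' {n : ℕ} {a : List ℕ} : CEq n a a := ⟨List.Perm.refl _, fun _ => rfl⟩

lemma CEq.symm' {n : ℕ} {a b : List ℕ} (h : CEq n a b) : CEq n b a :=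
  ⟨h.1.symm, fun S => (h.2 S).symm⟩

lemma sA_comm_prod {n i : ℕ} {b : List ℕ} (h : ∀ j ∈ b, j + 1 < i) :
    sA n i * prodA n b = prodA n b * sA n i := by
  induction b with
  | nil => simp [prodA]
  | cons j b ih =>
    rw [prodA_cons, ← mul_assoc, sA_comm n i j (Or.inr (Or.inl (h j (by simp)))), mul_assoc,
      ih (fun k hk => h k (by simp [hk])), mul_assoc]

lemma ceq_move {n i : ℕ} {b : List ℕ} (h : ∀ j ∈ b, j + 1 < i) :
    CEq n ([i] ++ b) (b ++ [i]) := by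
  refine ⟨List.perm_append_comm, fun S => ?_⟩
  rw [List.filter_append, List.filter_append, prodA_append, prodA_append]
  by_cases hi : i ∈ S
  · simp only [hi, List.filter_cons, List.filter_nil, decide_true, if_true]
    have : prodA n [i] = sA n i := by simp [prodA]
    rw [this]
    exact sA_comm_prod (fun j hj => h j (List.mem_filter.1 hj).1)
  · simp [hi, prodA]

lemma exists_can {n m : ℕ} {b : List ℕ} (hb : b.Nodup) (h : ∀ i ∈ b, 1 ≤ i ∧ i ≤ m) :
    ∃ c ∈ canW m, CEq n b c := by
  induction m generalizing b with
  | zero =>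
    refine ⟨[], by simp [canW], ?_⟩
    rcases b with _ | ⟨i, b⟩
    · exact CEq.rfl'
    · have := h i (by simp); omega
  | succ m ih =>
    by_cases hm : m + 1 ∈ b
    · obtain ⟨x, y, rfl⟩ := List.append_of_mem hm
      have hnd := List.nodup_middle.1 hb
      rw [List.nodup_cons] at hnd
      have hxy : ∀ i ∈ x ++ y, 1 ≤ i ∧ i ≤ m := by
        intro i hi
        have h1 := h i (by simp at hi ⊢; tauto)
        have : i ≠ m + 1 := by rintro rfl; exact hnd.1 hi
        omega
      obtain ⟨c, hc, hce⟩ := ih hnd.2 hxy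
      by_cases hmx : m ∈ x
      · refine ⟨c ++ [m + 1], ?_, ?_⟩
        · simp only [canW, Finset.mem_union, Finset.mem_image, Finset.mem_filter]
          exact Or.inr ⟨c, ⟨hc, hce.1.subset (by simp [hmx])⟩, rfl⟩
        · have hmy : ∀ j ∈ y, j + 1 < m + 1 := by
            intro j hj
            have h1 := hxy j (by simp [hj])
            have : j ≠ m := by
              rintro rfl
              exact (List.disjoint_of_nodup_append hnd.2) hmx hj
            omega
          have := (CEq.rfl' (n := n) (a := x)).append (ceq_move (n := n) hmy)
          rw [← List.append_assoc x y] at this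
          exact this.trans (hce.append CEq.rfl')
      · refine ⟨(m + 1) :: c, ?_, ?_⟩
        · simp only [canW, Finset.mem_union, Finset.mem_image, Finset.mem_filter]
          exact Or.inl (Or.inr ⟨c, hc, rfl⟩)
        · have hmy : ∀ j ∈ x, j + 1 < m + 1 := by
            intro j hj
            have h1 := hxy j (by simp [hj])
            have : j ≠ m := by
              rintro rfl
              exact hmx hj
            omega
          have := (ceq_move (n := n) hmy).symm'.append (CEq.rfl' (n := n) (a := y))
          rw [List.append_assoc, List.append_assoc] at this
          exact this.trans ((CEq.rfl' (n := n) (a := [m+1])).append hce)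
    · obtain ⟨c, hc, hce⟩ := ih hb (fun i hi => by
        have h1 := h i hi
        have : i ≠ m + 1 := by rintro rfl; exact hm hi
        omega)
      refine ⟨c, ?_, hce⟩
      simp only [canW, Finset.mem_union]
      exact Or.inl (Or.inl hc)

lemma prodA_fix {n m : ℕ} {b : List ℕ} (h : ∀ i ∈ b, 1 ≤ i ∧ i ≤ m) (x : Fin n) (hx : m < x) :
    prodA n b x = x := by
  induction b with
  | nil => simp [prodA]
  | cons j b ih =>
    rw [prodA_cons, Equiv.Perm.mul_apply, ih (fun i hi => h i (by simp [hi]))]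
    have := h j (by simp)
    ext
    rw [sA_val n j this.1 (by omega)]
    split_ifs <;> omega

lemma prodA_move {n m : ℕ} {b : List ℕ} (hb : b.Nodup) (h : ∀ i ∈ b, 1 ≤ i ∧ i ≤ m)
    (hm : m ∈ b) (hmn : m < n) : prodA n b ⟨m, hmn⟩ ≠ ⟨m, hmn⟩ := by
  intro heq
  have hw : IsWordA n b := fun i hi => by have := h i hi; omega
  apply not_pres_of_nodup hw hb hm
  have hfix : ∀ x : Fin n, m ≤ x → prodA n b x = x := by
    intro x hx
    rcases hx.lt_or_eq with hx | hx
    · exact prodA_fix h x hx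
    · have : x = ⟨m, hmn⟩ := Fin.ext hx.symm
      rw [this, heq]
  intro x
  constructor
  · intro hx
    by_contra hh
    rw [hfix x (by omega)] at hx
    exact hh hx
  · intro hx
    by_contra hh
    have := (prodA n b).injective (hfix (prodA n b x) (by omega))
    rw [this] at hh
    exact hh hx

lemma canW_inj {n m : ℕ} (hmn : m < n) {b c : List ℕ} (hb : b ∈ canW m) (hc : c ∈ canW m)
    (h : prodA n b = prodA n c) : b = c := by
  induction m generalizing b c with
  | zero => simp [canW] at hb hc; rw [hb, hc]
  | succ m ih =>
    have hwb : IsWordA n b := fun i hi => by have := canW_mem_letters hb i hi; omega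
    have hwc : IsWordA n c := fun i hi => by have := canW_mem_letters hc i hi; omega
    have hmem : m + 1 ∈ b ↔ m + 1 ∈ c := by
      rw [reduced_mem_iff (reduced_of_nodup hwb (canW_nodup hb)),
        reduced_mem_iff (reduced_of_nodup hwc (canW_nodup hc)), h]
    have hnot : ∀ d ∈ canW m, m + 1 ∉ d := fun d hd hh => by
      have := canW_mem_letters hd _ hh; omega
    have key : ∀ b ∈ canW m, ∀ c ∈ canW m, m ∈ c →
        prodA n ((m + 1) :: b) ≠ prodA n (c ++ [m + 1]) := by
      intro b hb c hc hmc heq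
      have h1 := congrArg (fun p => p (⟨m + 1, hmn⟩ : Fin n)) heq
      simp only [prodA_cons, prodA_append, Equiv.Perm.mul_apply, prodA_nil, mul_one] at h1
      rw [prodA_fix (canW_mem_letters hb) _ (by simp)] at h1
      have h2 : sA n (m + 1) ⟨m + 1, hmn⟩ = ⟨m, by omega⟩ := by
        ext
        rw [sA_val n _ (by omega) hmn]
        simp
      rw [h2] at h1
      exact prodA_move (canW_nodup hc) (canW_mem_letters hc) hmc (by omega) h1.symm
    simp only [canW, Finset.mem_union, Finset.mem_image, Finset.mem_filter] at hb hc
    rcases hb with (hb | ⟨b, hb, rfl⟩) | ⟨b, ⟨hb, hb2⟩, rfl⟩ <;>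
    rcases hc with (hc | ⟨c, hc, rfl⟩) | ⟨c, ⟨hc, hc2⟩, rfl⟩
    · exact ih (by omega) hb hc h
    · exact absurd (hmem.2 (by simp)) (hnot b hb)
    · exact absurd (hmem.2 (by simp)) (hnot b hb)
    · exact absurd (hmem.1 (by simp)) (hnot c hc)
    · rw [prodA_cons, prodA_cons] at h
      rw [ih (by omega) hb hc (mul_left_cancel h)]
    · exact absurd h (key b hb c hc hc2)
    · exact absurd (hmem.1 (by simp)) (hnot c hc)
    · exact absurd h.symm (key c hc b hb hb2)
    · rw [prodA_append, prodA_append] at h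
      rw [ih (by omega) hb hc (mul_right_cancel h)]

lemma filter_prod_eq {n : ℕ} (hn : 1 ≤ n) {b c : List ℕ} (hb : b.Nodup) (hc : c.Nodup)
    (hwb : IsWordA n b) (hwc : IsWordA n c) (h : prodA n b = prodA n c) (S : Finset ℕ) :
    prodA n (b.filter (· ∈ S)) = prodA n (c.filter (· ∈ S)) := by
  obtain ⟨b', hb', hbe⟩ := exists_can (n := n) hb hwb
  obtain ⟨c', hc', hce⟩ := exists_can (n := n) hc hwc
  have full : ∀ x y : List ℕ, CEq n x y → prodA n x = prodA n y := by
    intro x y hxy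
    have := hxy.2 x.toFinset
    rwa [List.filter_eq_self.2 (by simp), List.filter_eq_self.2 (by
      intro a ha; simpa using hxy.1.symm.subset ha)] at this
  have : b' = c' := canW_inj (n := n) (m := n - 1) (by omega) hb' hc' (by
    rw [← full _ _ hbe, ← full _ _ hce, h])
  subst this
  rw [hbe.2, hce.2]

lemma sublist_nodup_eq_filter {a b : List ℕ} (hb : b.Nodup) (h : a.Sublist b) :
    a = b.filter (· ∈ a.toFinset) := by
  induction h with
  | slnil => rfl
  | @cons a b x h ih =>
    rw [List.nodup_cons] at hb
    have : x ∉ a := fun hh => hb.1 (h.subset hh)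
    rw [List.filter_cons_of_neg (by simpa using this)]
    exact ih hb.2
  | @cons_cons a b x h ih =>
    rw [List.nodup_cons] at hb
    rw [List.filter_cons_of_pos (by simp)]
    congr 1
    refine (ih hb.2).trans (List.filter_congr ?_)
    intro y hy
    have : y ≠ x := by rintro rfl; exact hb.1 hy
    simp [this]

/-- Permutations with a reduced word with distinct letters are boolean. -/
lemma nodup_boolean {n : ℕ} (hn : 1 ≤ n) {b : List ℕ} (hw : IsWordA n b) (hb : b.Nodup) :
    BooleanA n (prodA n b) := by
  classical
  have hbr := reduced_of_nodup hw hb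
  have hfw : ∀ S : Finset ℕ, IsWordA n (b.filter (· ∈ S)) := fun S i hi =>
    hw i (List.mem_filter.1 hi).1
  have hfr : ∀ S : Finset ℕ, ReducedA n (b.filter (· ∈ S)) (prodA n (b.filter (· ∈ S))) :=
    fun S => reduced_of_nodup (hfw S) (hb.filter _)
  have hform : ∀ v, bruhatA n v (prodA n b) → ∃ S ⊆ b.toFinset, prodA n (b.filter (· ∈ S)) = v := by
    rintro v ⟨a, b', ha, hb', hab⟩
    have hnd := reduced_nodup hbr hb' hb
    refine ⟨a.toFinset, ?_, ?_⟩
    · intro i hi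
      rw [List.mem_toFinset] at *
      rw [reduced_mem_iff hbr, ← reduced_mem_iff hb']
      exact hab.subset hi
    · rw [filter_prod_eq hn hb hnd hw hb'.1 hb'.2.1.symm, ← sublist_nodup_eq_filter hnd hab,
        ha.2.1]
  have hle : ∀ S : Finset ℕ, bruhatA n (prodA n (b.filter (· ∈ S))) (prodA n b) := fun S =>
    ⟨_, b, hfr S, hbr, List.filter_sublist⟩
  have hle2 : ∀ S T : Finset ℕ, S ⊆ b.toFinset → T ⊆ b.toFinset →
      (bruhatA n (prodA n (b.filter (· ∈ S))) (prodA n (b.filter (· ∈ T))) ↔ S ⊆ T) := by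
    intro S T hS hT
    constructor
    · rintro ⟨a, c, ha, hc, hac⟩ i hi
      have h1 : i ∈ b.filter (· ∈ S) := by
        have := hS hi
        simp at this
        simp [this, hi]
      rw [reduced_mem_iff (hfr S), ← reduced_mem_iff ha] at h1
      have h2 := hac.subset h1
      rw [reduced_mem_iff hc, ← reduced_mem_iff (hfr T)] at h2
      simpa using (List.mem_filter.1 h2).2
    · intro hST
      refine ⟨_, _, hfr S, hfr T, ?_⟩
      exact List.monotone_filter_right b (fun i hi => by simp at hi ⊢; exact hST hi)
  let g : Finset (Fin b.length) → Finset ℕ := fun U => U.image (fun t => b.get t)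
  have hginj : Function.Injective g :=
    Finset.image_injective (List.nodup_iff_injective_get.1 hb)
  have hgsub : ∀ U, g U ⊆ b.toFinset := by
    intro U i hi
    obtain ⟨t, _, rfl⟩ := Finset.mem_image.1 hi
    rw [List.mem_toFinset]
    exact List.get_mem b t
  have hgU : ∀ U V, g U ⊆ g V ↔ U ⊆ V := fun U V =>
    Finset.image_subset_image_iff (List.nodup_iff_injective_get.1 hb)
  have hgsurj : ∀ S ⊆ b.toFinset, ∃ U, g U = S := by
    intro S hS
    refine ⟨Finset.univ.filter (fun t => b.get t ∈ S), ?_⟩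
    ext i
    simp only [g, Finset.mem_image, Finset.mem_filter, Finset.mem_univ, true_and]
    constructor
    · rintro ⟨t, ht, rfl⟩; exact ht
    · intro hi
      have := hS hi
      rw [List.mem_toFinset] at this
      obtain ⟨t, rfl⟩ := List.mem_iff_get.1 this
      exact ⟨t, hi, rfl⟩
  let F : Finset (Fin b.length) → {v : Equiv.Perm (Fin n) // bruhatA n v (prodA n b)} :=
    fun U => ⟨prodA n (b.filter (· ∈ g U)), hle _⟩
  have hF : ∀ U V, bruhatA n (F U).1 (F V).1 ↔ U ⊆ V := fun U V =>
    (hle2 _ _ (hgsub U) (hgsub V)).trans (hgU U V)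
  have hrefl : ∀ U, bruhatA n (F U).1 (F U).1 := fun U => (hF U U).2 (Finset.Subset.refl _)
  have hbij : Function.Bijective F := by
    constructor
    · intro U V hUV
      apply Finset.Subset.antisymm
      · rw [← hF, ← hUV]; exact hrefl U
      · rw [← hF, ← hUV]; exact hrefl U
    · rintro ⟨v, hv⟩
      obtain ⟨S, hS, rfl⟩ := hform v hv
      obtain ⟨U, rfl⟩ := hgsurj S hS
      exact ⟨U, rfl⟩
  refine ⟨b.length, (Equiv.ofBijective F hbij).symm, fun a c => ?_⟩
  obtain ⟨U, rfl⟩ := hbij.2 a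
  obtain ⟨V, rfl⟩ := hbij.2 c
  rw [hF]
  have : ∀ U, (Equiv.ofBijective F hbij).symm (F U) = U := fun U =>
    (Equiv.ofBijective F hbij).symm_apply_apply U
  rw [this, this]

lemma boolean_len_iff {n : ℕ} (hn : 1 ≤ n) (k : ℕ) (w : Equiv.Perm (Fin n)) :
    (BooleanA n w ∧ lenA n w = k) ↔
      w ∈ ((canW (n - 1)).filter (fun b => b.length = k)).image (prodA n) := by
  simp only [Finset.mem_image, Finset.mem_filter]
  constructor
  · rintro ⟨h, hk⟩
    obtain ⟨b, hb, hnd⟩ := boolean_nodup h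
    obtain ⟨c, hc, hce⟩ := exists_can (n := n) hnd hb.1
    refine ⟨c, ⟨hc, ?_⟩, ?_⟩
    · rw [← hk, lenA_of_reduced hb, hce.1.length_eq]
    · have := hce.2 b.toFinset
      rw [List.filter_eq_self.2 (by simp), List.filter_eq_self.2 (by
        intro a ha; simpa using hce.1.symm.subset ha)] at this
      rw [← this, hb.2.1]
  · rintro ⟨b, ⟨hb, hk⟩, rfl⟩
    have hw : IsWordA n b := canW_mem_letters hb
    exact ⟨nodup_boolean hn hw (canW_nodup hb),
      by rw [lenA_of_reduced (reduced_of_nodup hw (canW_nodup hb)), hk]⟩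

/-- Number of canonical words. -/
def cN (m k : ℕ) : ℕ := ((canW m).filter (fun b => b.length = k)).card

/-- Number of canonical words containing the last letter. -/
def cA (m k : ℕ) : ℕ := ((canW m).filter (fun b => m ∈ b ∧ b.length = k)).card

lemma card_boolean {n : ℕ} (hn : 1 ≤ n) (k : ℕ) :
    Nat.card {w : Equiv.Perm (Fin n) // BooleanA n w ∧ lenA n w = k} = cN (n - 1) k := by
  classical
  rw [Nat.card_congr (Equiv.subtypeEquivRight (boolean_len_iff hn k))]
  rw [Nat.card_eq_fintype_card, Fintype.card_coe, Finset.card_image_of_injOn]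
  · rfl
  · intro b hb c hc h
    simp only [Finset.coe_filter, Set.mem_setOf_eq] at hb hc
    exact canW_inj (by omega) hb.1 hc.1 h

lemma cA_succ (m k : ℕ) : cA (m + 1) (k + 1) = cN m k + cA m k := by
  unfold cA cN
  have hnot : ∀ d ∈ canW m, m + 1 ∉ d := fun d hd hh => by
    have := canW_mem_letters hd _ hh; omega
  have : (canW (m + 1)).filter (fun b => m + 1 ∈ b ∧ b.length = k + 1) =
      ((canW m).filter (fun b => b.length = k)).image (fun b => (m + 1) :: b) ∪
      ((canW m).filter (fun b => m ∈ b ∧ b.length = k)).image (fun b => b ++ [m + 1]) := by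
    ext b
    simp only [canW, Finset.mem_union, Finset.mem_image, Finset.mem_filter]
    constructor
    · rintro ⟨(h | ⟨c, h, rfl⟩) | ⟨c, ⟨h, h'⟩, rfl⟩, h2, h3⟩
      · exact absurd h2 (hnot _ h)
      · exact Or.inl ⟨c, ⟨h, by simpa using h3⟩, rfl⟩
      · exact Or.inr ⟨c, ⟨h, h', by simpa using h3⟩, rfl⟩
    · rintro (⟨c, ⟨h, h'⟩, rfl⟩ | ⟨c, ⟨h, h', h''⟩, rfl⟩)
      · exact ⟨Or.inl (Or.inr ⟨c, h, rfl⟩), by simp, by simp [h']⟩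
      · exact ⟨Or.inr ⟨c, ⟨h, h'⟩, rfl⟩, by simp, by simp [h'']⟩
  rw [this, Finset.card_union_of_disjoint, Finset.card_image_of_injective,
    Finset.card_image_of_injective]
  · intro a b h; simpa using h
  · intro a b h; simpa using h
  · rw [Finset.disjoint_left]
    intro b hb hb'
    obtain ⟨c, hc, rfl⟩ := Finset.mem_image.1 hb
    obtain ⟨d, hd, hcd⟩ := Finset.mem_image.1 hb'
    rw [Finset.mem_filter] at hd
    rcases d with _ | ⟨i, d⟩
    · simp at hd
    · simp only [List.cons_append, List.cons.injEq] at hcd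
      exact hnot _ hd.1 (by simp [hcd.1])

lemma cN_succ (m k : ℕ) : cN (m + 1) k = cN m k + cA (m + 1) k := by
  unfold cA cN
  have hnot : ∀ d ∈ canW m, m + 1 ∉ d := fun d hd hh => by
    have := canW_mem_letters hd _ hh; omega
  rw [← Finset.card_union_of_disjoint]
  · congr 1
    ext b
    simp only [canW, Finset.mem_union, Finset.mem_image, Finset.mem_filter]
    constructor
    · rintro ⟨(h | ⟨c, h, rfl⟩) | ⟨c, ⟨h, h'⟩, rfl⟩, h3⟩
      · exact Or.inl ⟨h, h3⟩
      · exact Or.inr ⟨Or.inl (Or.inr ⟨c, h, rfl⟩), by simp, h3⟩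
      · exact Or.inr ⟨Or.inr ⟨c, ⟨h, h'⟩, rfl⟩, by simp, h3⟩
    · rintro (h | ⟨h, h2, h3⟩)
      · exact ⟨Or.inl (Or.inl h.1), h.2⟩
      · exact ⟨h, h3⟩
  · rw [Finset.disjoint_left]
    intro b hb hb'
    rw [Finset.mem_filter] at hb hb'
    exact hnot _ hb.1 hb'.2.1

lemma cN_zero_succ (k : ℕ) : cN 0 (k + 1) = 0 := by
  simp [cN, canW]

lemma cA_zero (k : ℕ) : cA 0 k = 0 := by
  simp [cA, canW]

lemma cA_len_zero (m : ℕ) : cA m 0 = 0 := by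
  unfold cA
  rw [Finset.card_eq_zero, Finset.filter_eq_empty_iff]
  rintro b _ ⟨h1, h2⟩
  rw [List.length_eq_zero_iff] at h2
  simp [h2] at h1

lemma cN_len_zero (m : ℕ) : cN m 0 = 1 := by
  induction m with
  | zero => rfl
  | succ m ih => rw [cN_succ, ih, cA_len_zero]

lemma cN_big (m k : ℕ) (h : m < k) : cN m k = 0 ∧ cA m k = 0 := by
  induction m generalizing k with
  | zero =>
    obtain ⟨k, rfl⟩ := Nat.exists_eq_succ_of_ne_zero h.ne'
    exact ⟨cN_zero_succ k, cA_zero _⟩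
  | succ m ih =>
    obtain ⟨k, rfl⟩ := Nat.exists_eq_succ_of_ne_zero (by omega : k ≠ 0)
    have h1 : cA (m + 1) (k + 1) = 0 := by
      rw [cA_succ, (ih k (by omega)).1, (ih k (by omega)).2]
    exact ⟨by rw [Nat.succ_eq_add_one, cN_succ, h1, (ih (k + 1) (by omega)).1], h1⟩

lemma cN_cA_formula (m : ℕ) : ∀ l, l ≤ m →
    cN m (l + 1) = ∑ j ∈ Finset.range (l + 1), Nat.choose (m - j) (l + 1 - j) * Nat.choose l j ∧
    cA (m + 1) (l + 1) = ∑ j ∈ Finset.range (l + 1), Nat.choose (m - j) (l - j) * Nat.choose l j := by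
  induction m with
  | zero =>
    intro l hl
    obtain rfl : l = 0 := by omega
    rw [cA_succ, cN_zero_succ, cN_len_zero, cA_zero]
    simp
  | succ m ih =>
    have hN : ∀ l, l ≤ m + 1 → cN (m + 1) (l + 1) =
        ∑ j ∈ Finset.range (l + 1), Nat.choose (m + 1 - j) (l + 1 - j) * Nat.choose l j := by
      intro l hl
      rcases hl.lt_or_eq with hl | rfl
      · obtain ⟨h1, h2⟩ := ih l (by omega)
        rw [cN_succ, h1, h2, ← Finset.sum_add_distrib]
        refine Finset.sum_congr rfl fun j hj => ?_
        rw [Finset.mem_range] at hj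
        rw [show m + 1 - j = (m - j) + 1 by omega, show l + 1 - j = (l - j) + 1 by omega,
          Nat.choose_succ_succ]
        ring
      · rw [(cN_big _ _ (by omega)).1]
        symm
        refine Finset.sum_eq_zero fun j hj => ?_
        rw [Finset.mem_range] at hj
        rw [Nat.choose_eq_zero_of_lt (by omega), zero_mul]
    intro l hl
    refine ⟨hN l hl, ?_⟩
    rw [cA_succ]
    rcases l with _ | l
    · rw [cN_len_zero, cA_len_zero]; simp
    · rw [hN l (by omega), (ih l (by omega)).2]
      conv_rhs => rw [Finset.sum_range_succ']
      have e : ∀ j ∈ Finset.range (l + 1),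
          Nat.choose (m + 1 - (j + 1)) (l + 1 - (j + 1)) * Nat.choose (l + 1) (j + 1) =
          Nat.choose (m - j) (l - j) * Nat.choose l j +
          Nat.choose (m + 1 - (j + 1)) (l + 1 - (j + 1)) * Nat.choose l (j + 1) := by
        intro j _
        rw [Nat.choose_succ_succ, Nat.add_sub_add_right, Nat.add_sub_add_right]
        ring
      rw [Finset.sum_congr rfl e, Finset.sum_add_distrib]
      have e2 := Finset.sum_range_succ'
        (fun j => Nat.choose (m + 1 - j) (l + 1 - j) * Nat.choose l j) (l + 1)
      rw [Finset.sum_range_succ] at e2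
      simp only [Nat.choose_succ_self, mul_zero, add_zero] at e2
      rw [e2]
      simp only [Nat.choose_zero_right]
      ring

theorem stmt3 (n k : ℕ) (hn : 1 ≤ n) :
    (1 ≤ k →
      Nat.card {w : Equiv.Perm (Fin n) // BooleanA n w ∧ lenA n w = k} =
        ∑ i ∈ Finset.Icc 1 k, Nat.choose (n - i) (k + 1 - i) * Nat.choose (k - 1) (i - 1)) ∧
    Nat.card {w : Equiv.Perm (Fin n) // BooleanA n w ∧ lenA n w = 0} = 1 := by
  refine ⟨fun hk => ?_, by rw [card_boolean hn, cN_len_zero]⟩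
  rw [card_boolean hn]
  obtain ⟨l, rfl⟩ := Nat.exists_eq_succ_of_ne_zero (by omega : k ≠ 0)
  obtain ⟨m, rfl⟩ := Nat.exists_eq_succ_of_ne_zero (by omega : n ≠ 0)
  have hsum : ∑ i ∈ Finset.Icc 1 (l + 1),
      Nat.choose (m + 1 - i) (l + 1 + 1 - i) * Nat.choose (l + 1 - 1) (i - 1) =
      ∑ j ∈ Finset.range (l + 1), Nat.choose (m - j) (l + 1 - j) * Nat.choose l j := by
    rw [← Finset.Ico_add_one_right_eq_Icc, Finset.sum_Ico_eq_sum_range]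
    refine Finset.sum_congr (by simp) fun j _ => ?_
    congr 2 <;> omega
  simp only [Nat.succ_eq_add_one, Nat.add_sub_cancel] at hsum ⊢
  rw [hsum]
  by_cases hl : l ≤ m
  · exact (cN_cA_formula m l hl).1
  · rw [(cN_big _ _ (by omega)).1]
    symm
    refine Finset.sum_eq_zero fun j hj => ?_
    rw [Finset.mem_range] at hj
    rw [Nat.choose_eq_zero_of_lt (by omega), zero_mul]

end Paper
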